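/- Let J₁ and J₂ be nonsingular J-tensors for the metric g on U, σ_a = det J_a (a = 1,2), and let V, W : U → ℝ be smooth potentials satisfying the bi-cofactor condition (cof J₁)⁻¹∇V = (cof J₂)⁻¹∇W on U. Define H(q,p) = (1/2)pᵀ(cof J₁)Gp + V(q) and F(q,p) = (1/2)pᵀ(cof J₂)Gp + W(q). Then the two vector fields on U × ℝⁿ coincide: (1/σ₁) Π_nc(J₁) dH = (1/σ₂) Π_nc(J₂) dF at every point (q,p), and a smooth curve q : I → U solves the bi-cofactor Newton system d²q^i/dt² + Γ^i_{jk}(dq^j/dt)(dq^k/dt) = −((cof J₁)⁻¹∇V)^i if and only if (q(t), p(t) = g(q(t))q̇(t)) is an integral curve of this common vector field. -/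

import Mathlib

noncomputable section
open Matrix

/-- Partial derivative `∂f/∂q^i` of a scalar function on `ℝⁿ`. -/
def pd {n : ℕ} (f : (Fin n → ℝ) → ℝ) (i : Fin n) (q : Fin n → ℝ) : ℝ :=
  fderiv ℝ f q (Pi.single i 1)

/-- Christoffel symbols `Γ^i_{jk}` of a metric `g` (with `G = g⁻¹`). -/
def christoffel {n : ℕ} (g : (Fin n → ℝ) → Matrix (Fin n) (Fin n) ℝ)
    (i j k : Fin n) (q : Fin n → ℝ) : ℝ :=
  (1 / 2) * ∑ l, (g q)⁻¹ i l *
    (pd (fun q' => g q' l k) j q + pd (fun q' => g q' l j) k q - pd (fun q' => g q' j k) l q)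

/-- Gradient with respect to the metric `g`: `(∇V)^i = G^{ij} ∂_j V`. -/
def grad {n : ℕ} (g : (Fin n → ℝ) → Matrix (Fin n) (Fin n) ℝ)
    (V : (Fin n → ℝ) → ℝ) (q : Fin n → ℝ) : Fin n → ℝ :=
  (g q)⁻¹ *ᵥ (fun j => pd V j q)

/-- Covariant derivative `∇_h J^i_j` of a (1,1)-tensor field. -/
def covDeriv {n : ℕ} (g J : (Fin n → ℝ) → Matrix (Fin n) (Fin n) ℝ)
    (h i j : Fin n) (q : Fin n → ℝ) : ℝ :=
  pd (fun q' => J q' i j) h q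
    + ∑ l, christoffel g i h l q * J q l j
    - ∑ l, christoffel g l h j q * J q i l

/-- `J` is a J-tensor for the metric `g` on `U`: `JG` is symmetric and
`∇_h J^i_j = α_j δ^i_h + α^i g_{jh}` for some 1-form `α`. -/
def IsJTensor {n : ℕ} (U : Set (Fin n → ℝ))
    (g J : (Fin n → ℝ) → Matrix (Fin n) (Fin n) ℝ) : Prop :=
  (∀ i j, ContDiffOn ℝ (⊤ : ℕ∞) (fun q => J q i j) U) ∧
  (∀ q ∈ U, (J q * (g q)⁻¹).IsSymm) ∧
  ∃ α : (Fin n → ℝ) → (Fin n → ℝ), ∀ q ∈ U, ∀ h i j,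
    covDeriv g J h i j q =
      α q j * (if i = h then (1 : ℝ) else 0) + (∑ k, (g q)⁻¹ i k * α q k) * g q j h

/-- The matrix `Ω^i_j = (∂J^k_i/∂q^j − ∂J^k_j/∂q^i) p_k` appearing in the
lower-right block of the noncanonical Poisson operator `Π_nc(J)`. -/
def Omega {n : ℕ} (J : (Fin n → ℝ) → Matrix (Fin n) (Fin n) ℝ)
    (q p : Fin n → ℝ) (i j : Fin n) : ℝ :=
  ∑ k, (pd (fun q' => J q' k i) j q - pd (fun q' => J q' k j) i q) * p k

/-- The entrywise directional derivative of a matrix-valued map. -/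
def matDeriv {n : ℕ} (M : (Fin n → ℝ) → Matrix (Fin n) (Fin n) ℝ) (q x : Fin n → ℝ) :
    Matrix (Fin n) (Fin n) ℝ :=
  Matrix.of fun i j => fderiv ℝ (fun q' => M q' i j) q x

/-- The connection matrix `Γ(x)^i_l = x^h Γ^i_{hl}`. -/
def connMat {n : ℕ} (g : (Fin n → ℝ) → Matrix (Fin n) (Fin n) ℝ) (q x : Fin n → ℝ) :
    Matrix (Fin n) (Fin n) ℝ :=
  Matrix.of fun i l => ∑ h, x h * christoffel g i h l q

/-- The quasi-Hamiltonian `½ pᵀ (cof J) G p + V`. -/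
def quasiHamiltonian {n : ℕ} (g J : (Fin n → ℝ) → Matrix (Fin n) (Fin n) ℝ)
    (V : (Fin n → ℝ) → ℝ) (q p : Fin n → ℝ) : ℝ :=
  (1 / 2) * (p ⬝ᵥ (((J q).adjugate * (g q)⁻¹) *ᵥ p)) + V q

section Calculus

variable {n : ℕ}

lemma fderiv_apply_eq_sum_pd (f : (Fin n → ℝ) → ℝ) (q x : Fin n → ℝ) :
    fderiv ℝ f q x = ∑ h, x h * pd f h q := by
  conv_lhs => rw [pi_eq_sum_univ' x]
  simp [map_sum, pd]

lemma matDeriv_mul {M N : (Fin n → ℝ) → Matrix (Fin n) (Fin n) ℝ} {q : Fin n → ℝ}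
    (hM : ∀ i j, DifferentiableAt ℝ (fun q' => M q' i j) q)
    (hN : ∀ i j, DifferentiableAt ℝ (fun q' => N q' i j) q) (x : Fin n → ℝ) :
    matDeriv (fun q' => M q' * N q') q x = matDeriv M q x * N q + M q * matDeriv N q x := by
  ext i j
  simp only [matDeriv, Matrix.of_apply, Matrix.add_apply, Matrix.mul_apply]
  have hd : ∀ k ∈ Finset.univ, DifferentiableAt ℝ (fun q' => M q' i k * N q' k j) q :=
    fun k _ => (hM i k).mul (hN k j)
  rw [fderiv_fun_sum hd, ← Finset.sum_add_distrib, _root_.sum_apply]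
  refine Finset.sum_congr rfl fun k _ => ?_
  rw [fderiv_fun_mul (hM i k) (hN k j)]
  simp
  ring

lemma differentiableAt_mul_apply {M N : (Fin n → ℝ) → Matrix (Fin n) (Fin n) ℝ} {q : Fin n → ℝ}
    (hM : ∀ i j, DifferentiableAt ℝ (fun q' => M q' i j) q)
    (hN : ∀ i j, DifferentiableAt ℝ (fun q' => N q' i j) q) (i j : Fin n) :
    DifferentiableAt ℝ (fun q' => (M q' * N q') i j) q := by
  simp only [Matrix.mul_apply]
  exact DifferentiableAt.fun_sum fun k _ => (hM i k).mul (hN k j)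

lemma differentiableAt_det {E : Type*} [NormedAddCommGroup E] [NormedSpace ℝ E]
    {M : E → Matrix (Fin n) (Fin n) ℝ} {q : E}
    (hM : ∀ i j, DifferentiableAt ℝ (fun q' => M q' i j) q) :
    DifferentiableAt ℝ (fun q' => (M q').det) q := by
  simp only [Matrix.det_apply]
  exact DifferentiableAt.fun_sum fun s _ => DifferentiableAt.const_smul
    (HasFDerivAt.finsetProd fun i _ => (hM (s i) i).hasFDerivAt).differentiableAt _

lemma differentiableAt_adjugate_apply {M : (Fin n → ℝ) → Matrix (Fin n) (Fin n) ℝ}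
    {q : Fin n → ℝ} (hM : ∀ i j, DifferentiableAt ℝ (fun q' => M q' i j) q) (i j : Fin n) :
    DifferentiableAt ℝ (fun q' => (M q').adjugate i j) q := by
  simp only [Matrix.adjugate_apply]
  refine differentiableAt_det fun a b => ?_
  by_cases h : a = j
  · subst h; simp
  · simpa [Matrix.updateRow_ne h] using hM a b

lemma differentiableAt_inv_apply {M : (Fin n → ℝ) → Matrix (Fin n) (Fin n) ℝ} {q : Fin n → ℝ}
    (hM : ∀ i j, DifferentiableAt ℝ (fun q' => M q' i j) q) (hdet : (M q).det ≠ 0)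
    (i j : Fin n) : DifferentiableAt ℝ (fun q' => (M q')⁻¹ i j) q := by
  simp only [Matrix.inv_def, Ring.inverse_eq_inv', Matrix.smul_apply, smul_eq_mul]
  exact ((differentiableAt_det hM).inv hdet).mul (differentiableAt_adjugate_apply hM i j)

/-- Jacobi's formula. -/
lemma fderiv_det {M : (Fin n → ℝ) → Matrix (Fin n) (Fin n) ℝ} {q : Fin n → ℝ}
    (hM : ∀ i j, DifferentiableAt ℝ (fun q' => M q' i j) q) (x : Fin n → ℝ) :
    fderiv ℝ (fun q' => (M q').det) q x = ((M q).adjugate * matDeriv M q x).trace := by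
  let D : ContinuousMultilinearMap ℝ (fun _ : Fin n => Fin n → ℝ) ℝ :=
    { (Matrix.detRowAlternating (R := ℝ) (n := Fin n)).toMultilinearMap with
      cont := Continuous.matrix_det continuous_id }
  have hM' : HasFDerivAt (fun q' i => M q' i)
      (ContinuousLinearMap.pi fun i => ContinuousLinearMap.pi fun j =>
        fderiv ℝ (fun q' => M q' i j) q) q :=
    hasFDerivAt_pi.2 fun i => hasFDerivAt_pi.2 fun j => (hM i j).hasFDerivAt
  have h := (D.hasFDerivAt (fun i => M q i)).comp q hM'
  have h' : fderiv ℝ (fun q' => (M q').det) q = _ := h.fderiv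
  rw [h']
  have hrow : ∀ i : Fin n, D (Function.update (fun i => M q i) i (matDeriv M q x i)) =
      ∑ k, matDeriv M q x i k * (M q).adjugate k i := by
    intro i
    have : D (Function.update (fun i => M q i) i (matDeriv M q x i)) =
      ((M q).updateRow i (matDeriv M q x i)).det := rfl
    rw [this, Matrix.det_eq_sum_mul_adjugate_row _ i]
    refine Finset.sum_congr rfl fun k _ => ?_
    simp [Matrix.adjugate_apply]
  rw [Matrix.trace_mul_comm]
  simp only [Matrix.trace, Matrix.diag, Matrix.mul_apply, ← hrow]
  simp [ContinuousMultilinearMap.linearDeriv_apply]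
  rfl

lemma hasFDerivAt_dotProduct_mulVec {M : (Fin n → ℝ) → Matrix (Fin n) (Fin n) ℝ} {q : Fin n → ℝ}
    (hM : ∀ i j, DifferentiableAt ℝ (fun q' => M q' i j) q) (p : Fin n → ℝ) :
    HasFDerivAt (fun q' => p ⬝ᵥ (M q' *ᵥ p))
      (∑ i, p i • ∑ j, p j • fderiv ℝ (fun q' => M q' i j) q) q := by
  simp only [dotProduct, Matrix.mulVec]
  refine HasFDerivAt.fun_sum fun i _ => HasFDerivAt.const_mul ?_ _
  exact HasFDerivAt.fun_sum fun j _ => (hM i j).hasFDerivAt.mul_const _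

lemma pd_dotProduct_mulVec_self {N : Matrix (Fin n) (Fin n) ℝ} (hN : N.IsSymm) (c : ℝ)
    (i : Fin n) (p : Fin n → ℝ) :
    pd (fun p' => (1 / 2) * (p' ⬝ᵥ (N *ᵥ p')) + c) i p = (N *ᵥ p) i := by
  have hc : ∀ i, HasFDerivAt (fun p' : Fin n → ℝ => p' i)
      (ContinuousLinearMap.proj (R := ℝ) (φ := fun _ : Fin n => ℝ) i) p := fun i =>
    hasFDerivAt_apply i p
  have h := ((HasFDerivAt.fun_sum (u := Finset.univ) fun i _ => (hc i).mul
    (HasFDerivAt.fun_sum (u := Finset.univ) fun j _ => (hc j).const_mul (N i j))).const_mul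
      (1 / 2)).add_const c
  have h2 : fderiv ℝ (fun p' => (1 / 2) * (p' ⬝ᵥ (N *ᵥ p')) + c) p = _ := h.fderiv
  rw [pd, h2]
  simp [Finset.sum_add_distrib, Pi.single_apply, Matrix.mulVec, dotProduct]
  have : ∑ x, p x * N x i = ∑ x, N i x * p x :=
    Finset.sum_congr rfl fun _ _ => by rw [hN.apply i]; ring
  linarith

end Calculus

section Algebra

variable {n : ℕ}

lemma dotProduct_mulVec_eq_transpose (M : Matrix (Fin n) (Fin n) ℝ) (x y : Fin n → ℝ) :
    x ⬝ᵥ (M *ᵥ y) = (Mᵀ *ᵥ x) ⬝ᵥ y := by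
  rw [Matrix.dotProduct_mulVec, Matrix.mulVec_transpose]

/-- The pointwise identity that makes the kinetic parts of the quasi-Hamiltonian vector fields
agree with the geodesic flow. -/
lemma kinetic_identity {g J : Matrix (Fin n) (Fin n) ℝ}
    {dg dJ Γ : (Fin n → ℝ) → Matrix (Fin n) (Fin n) ℝ} {a α : Fin n → ℝ}
    (hgs : gᵀ = g) (ha : g *ᵥ a = α) (hJ : Jᵀ * g = g * J)
    (hΓ : ∀ x y, Γ x *ᵥ y = Γ y *ᵥ x)
    (hdg : ∀ x, dg x = g * Γ x + (Γ x)ᵀ * g)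
    (hdJ : ∀ x y, dJ x *ᵥ y =
      (α ⬝ᵥ y) • x + ((g *ᵥ x) ⬝ᵥ y) • a - Γ x *ᵥ (J *ᵥ y) + J *ᵥ (Γ x *ᵥ y))
    (w u : Fin n → ℝ) :
    (1 / 2) * (w ⬝ᵥ ((dg (J *ᵥ u) * J + g * dJ (J *ᵥ u)) *ᵥ w))
      - (α ⬝ᵥ u) * (w ⬝ᵥ (g *ᵥ (J *ᵥ w)))
      + (g *ᵥ (J *ᵥ w)) ⬝ᵥ (dJ w *ᵥ u) - (g *ᵥ (J *ᵥ w)) ⬝ᵥ (dJ u *ᵥ w)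
      = (g *ᵥ (J *ᵥ w)) ⬝ᵥ (Γ u *ᵥ (J *ᵥ w)) := by
  have hsw : ∀ x y, x ⬝ᵥ (g *ᵥ y) = (g *ᵥ x) ⬝ᵥ y := fun x y => by
    rw [dotProduct_mulVec_eq_transpose, hgs]
  have hgJ : ∀ x y, (g *ᵥ x) ⬝ᵥ (J *ᵥ y) = (g *ᵥ (J *ᵥ x)) ⬝ᵥ y := fun x y => by
    rw [dotProduct_mulVec_eq_transpose, mulVec_mulVec, hJ, mulVec_mulVec]
  have hT : ∀ x y z, y ⬝ᵥ ((Γ x)ᵀ *ᵥ z) = (Γ x *ᵥ y) ⬝ᵥ z := fun x y z => by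
    rw [dotProduct_mulVec_eq_transpose, transpose_transpose]
  simp only [add_mulVec, ← mulVec_mulVec, hdg, hdJ, dotProduct_add, dotProduct_sub, hT, hsw,
    dotProduct_smul, smul_eq_mul, hgJ, mulVec_add]
  rw [hΓ w (J *ᵥ u), hΓ w u]
  have e1 : (g *ᵥ w) ⬝ᵥ a = α ⬝ᵥ w := by rw [← hsw, ha, dotProduct_comm]
  have e3 : (g *ᵥ (J *ᵥ (Γ (J *ᵥ u) *ᵥ w))) ⬝ᵥ w = (g *ᵥ (J *ᵥ w)) ⬝ᵥ (Γ (J *ᵥ u) *ᵥ w) := by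
    rw [← hgJ, ← hsw, dotProduct_comm]
  have e4 : (g *ᵥ (J *ᵥ u)) ⬝ᵥ w = (g *ᵥ (J *ᵥ w)) ⬝ᵥ u := by
    rw [← hsw, ← hgJ, dotProduct_comm]
  have e5 : (g *ᵥ u) ⬝ᵥ w = (g *ᵥ w) ⬝ᵥ u := by rw [← hsw, dotProduct_comm]
  simp only [e1, e3, e4, e5]
  ring

end Algebra

section Geometry

variable {n : ℕ} {U : Set (Fin n → ℝ)} {g J : (Fin n → ℝ) → Matrix (Fin n) (Fin n) ℝ}
  {q : Fin n → ℝ}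

lemma differentiableAt_of_contDiffOn {E : Type*} [NormedAddCommGroup E] [NormedSpace ℝ E]
    {S : Set E} (hS : IsOpen S) {f : E → ℝ} (hf : ContDiffOn ℝ (⊤ : ℕ∞) f S) {x : E}
    (hx : x ∈ S) : DifferentiableAt ℝ f x :=
  (hf.contDiffAt (hS.mem_nhds hx)).differentiableAt (by simp)

lemma pd_metric_symm (hU : IsOpen U) (hgsym : ∀ q ∈ U, (g q).IsSymm) (hq : q ∈ U)
    (i j h : Fin n) : pd (fun q' => g q' i j) h q = pd (fun q' => g q' j i) h q := by
  have : (fun q' => g q' i j) =ᶠ[nhds q] fun q' => g q' j i := by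
    filter_upwards [hU.mem_nhds hq] with q' hq' using (hgsym q' hq').apply j i
  rw [pd, pd, this.fderiv_eq]

lemma christoffel_symm (hU : IsOpen U) (hgsym : ∀ q ∈ U, (g q).IsSymm) (hq : q ∈ U)
    (i j k : Fin n) : christoffel g i j k q = christoffel g i k j q := by
  unfold christoffel
  congr 1
  refine Finset.sum_congr rfl fun l _ => ?_
  rw [pd_metric_symm hU hgsym hq j k l]
  ring

lemma connMat_mulVec_comm (hU : IsOpen U) (hgsym : ∀ q ∈ U, (g q).IsSymm) (hq : q ∈ U)
    (x y : Fin n → ℝ) : connMat g q x *ᵥ y = connMat g q y *ᵥ x := by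
  ext i
  simp only [connMat, Matrix.mulVec, dotProduct, Matrix.of_apply, Finset.sum_mul]
  rw [Finset.sum_comm]
  refine Finset.sum_congr rfl fun a _ => Finset.sum_congr rfl fun b _ => ?_
  rw [christoffel_symm hU hgsym hq i a b]
  ring

/-- The metric is parallel. -/
lemma matDeriv_metric (hU : IsOpen U) (hgsym : ∀ q ∈ U, (g q).IsSymm)
    (hginv : IsUnit (g q).det) (hq : q ∈ U) (x : Fin n → ℝ) :
    matDeriv g q x = g q * connMat g q x + (connMat g q x)ᵀ * g q := by
  set B : Matrix (Fin n) (Fin n) ℝ := Matrix.of fun m b => ∑ h, x h *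
    (pd (fun q' => g q' m b) h q + pd (fun q' => g q' m h) b q - pd (fun q' => g q' h b) m q)
    with hB
  have hconn : connMat g q x = (1 / 2 : ℝ) • ((g q)⁻¹ * B) := by
    ext i l
    simp only [connMat, christoffel, hB, Matrix.of_apply, Matrix.smul_apply, Matrix.mul_apply,
      smul_eq_mul, Finset.mul_sum]
    rw [Finset.sum_comm]
    refine Finset.sum_congr rfl fun a _ => Finset.sum_congr rfl fun b _ => ?_
    ring
  have hlow : g q * connMat g q x = (1 / 2 : ℝ) • B := by
    rw [hconn, Matrix.mul_smul, Matrix.mul_nonsing_inv_cancel_left _ _ hginv]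
  have htr : (connMat g q x)ᵀ * g q = (g q * connMat g q x)ᵀ := by
    rw [Matrix.transpose_mul, (hgsym q hq).eq]
  rw [htr, hlow]
  ext a b
  simp only [matDeriv, hB, Matrix.of_apply, Matrix.smul_apply, Matrix.add_apply,
    Matrix.transpose_apply, smul_eq_mul, fderiv_apply_eq_sum_pd, ← mul_add,
    ← Finset.sum_add_distrib]
  rw [Finset.mul_sum]
  refine Finset.sum_congr rfl fun h _ => ?_
  rw [pd_metric_symm hU hgsym hq b a h, pd_metric_symm hU hgsym hq h b a,
    pd_metric_symm hU hgsym hq h a b]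
  ring

lemma matDeriv_of_covDeriv {α : Fin n → ℝ}
    (hα : ∀ h i j, covDeriv g J h i j q =
      α j * (if i = h then (1 : ℝ) else 0) + (∑ k, (g q)⁻¹ i k * α k) * g q j h)
    (x : Fin n → ℝ) :
    matDeriv J q x = vecMulVec x α + vecMulVec ((g q)⁻¹ *ᵥ α) (g q *ᵥ x)
      - connMat g q x * J q + J q * connMat g q x := by
  ext i j
  have hpd : ∀ h, pd (fun q' => J q' i j) h q =
      α j * (if i = h then (1 : ℝ) else 0) + (∑ k, (g q)⁻¹ i k * α k) * g q j h
        - ∑ l, christoffel g i h l q * J q l j + ∑ l, christoffel g l h j q * J q i l := by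
    intro h
    rw [← hα h i j, covDeriv]
    ring
  have h1 : ∑ h, x h * ∑ l, christoffel g i h l q * J q l j = (connMat g q x * J q) i j := by
    simp only [connMat, Matrix.mul_apply, Matrix.of_apply, Finset.mul_sum, Finset.sum_mul]
    rw [Finset.sum_comm]
    exact Finset.sum_congr rfl fun a _ => Finset.sum_congr rfl fun b _ => by ring
  have h2 : ∑ h, x h * ∑ l, christoffel g l h j q * J q i l = (J q * connMat g q x) i j := by
    simp only [connMat, Matrix.mul_apply, Matrix.of_apply, Finset.mul_sum]
    rw [Finset.sum_comm]
    exact Finset.sum_congr rfl fun a _ => Finset.sum_congr rfl fun b _ => by ring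
  have h3 : ∑ h, x h * ((∑ k, (g q)⁻¹ i k * α k) * g q j h) =
      ((g q)⁻¹ *ᵥ α) i * (g q *ᵥ x) j := by
    simp only [Matrix.mulVec, dotProduct]
    rw [Finset.mul_sum]
    exact Finset.sum_congr rfl fun a _ => by ring
  simp only [matDeriv, Matrix.of_apply, fderiv_apply_eq_sum_pd, hpd, mul_add, mul_sub,
    Finset.sum_add_distrib, Finset.sum_sub_distrib, h1, h2, h3, Matrix.add_apply,
    Matrix.sub_apply, vecMulVec_apply]
  simp

lemma transpose_mul_metric (hgs : (g q).IsSymm) (hginv : IsUnit (g q).det)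
    (hJG : (J q * (g q)⁻¹).IsSymm) : (J q)ᵀ * g q = g q * J q := by
  have h : (g q)⁻¹ * (J q)ᵀ = J q * (g q)⁻¹ := by
    have := hJG.eq
    rwa [Matrix.transpose_mul, Matrix.transpose_nonsing_inv, hgs.eq] at this
  calc (J q)ᵀ * g q = g q * ((g q)⁻¹ * (J q)ᵀ) * g q := by
        rw [Matrix.mul_nonsing_inv_cancel_left _ _ hginv]
    _ = g q * J q := by
        rw [h, ← Matrix.mul_assoc, Matrix.nonsing_inv_mul_cancel_right _ _ hginv]

lemma fderiv_det_of_covDeriv (hgs : (g q).IsSymm) (hginv : IsUnit (g q).det)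
    (hJG : (J q)ᵀ * g q = g q * J q) {α : Fin n → ℝ}
    (hJd : ∀ i j, DifferentiableAt ℝ (fun q' => J q' i j) q)
    (hα : ∀ h i j, covDeriv g J h i j q =
      α j * (if i = h then (1 : ℝ) else 0) + (∑ k, (g q)⁻¹ i k * α k) * g q j h)
    (u : Fin n → ℝ) :
    fderiv ℝ (fun q' => (J q').det) q (J q *ᵥ u) = 2 * (J q).det * (α ⬝ᵥ u) := by
  rw [fderiv_det hJd, matDeriv_of_covDeriv hα]
  have hcomm : ((J q).adjugate * (connMat g q (J q *ᵥ u) * J q)).trace =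
      ((J q).adjugate * (J q * connMat g q (J q *ᵥ u))).trace := by
    rw [← Matrix.mul_assoc, Matrix.trace_mul_comm, ← Matrix.mul_assoc, Matrix.mul_adjugate,
      ← Matrix.mul_assoc, Matrix.adjugate_mul]
  rw [Matrix.mul_add, Matrix.mul_sub, Matrix.mul_add, Matrix.trace_add, Matrix.trace_sub,
    Matrix.trace_add, hcomm, Matrix.mul_vecMulVec, Matrix.mul_vecMulVec, Matrix.trace_vecMulVec,
    Matrix.trace_vecMulVec]
  have h1 : (J q).adjugate *ᵥ (J q *ᵥ u) = (J q).det • u := by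
    rw [mulVec_mulVec, Matrix.adjugate_mul, Matrix.smul_mulVec, Matrix.one_mulVec]
  have h2 : ((J q).adjugate *ᵥ ((g q)⁻¹ *ᵥ α)) ⬝ᵥ (g q *ᵥ (J q *ᵥ u)) =
      (J q).det * (α ⬝ᵥ u) := by
    rw [mulVec_mulVec u, ← hJG, ← mulVec_mulVec, dotProduct_mulVec_eq_transpose,
      transpose_transpose, mulVec_mulVec _ (J q), Matrix.mul_adjugate, Matrix.smul_mulVec,
      Matrix.one_mulVec, smul_dotProduct, dotProduct_mulVec_eq_transpose, hgs.eq, mulVec_mulVec,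
      Matrix.mul_nonsing_inv _ hginv, Matrix.one_mulVec, smul_eq_mul]
  rw [h1, h2, smul_dotProduct, dotProduct_comm u α, smul_eq_mul]
  ring

lemma sum_Omega_mul (J : (Fin n → ℝ) → Matrix (Fin n) (Fin n) ℝ) (q p y : Fin n → ℝ)
    (i : Fin n) :
    ∑ j, Omega J q p i j * y j = p ⬝ᵥ (matDeriv J q y *ᵥ Pi.single i 1)
      - p ⬝ᵥ (matDeriv J q (Pi.single i 1) *ᵥ y) := by
  simp only [Omega, dotProduct, Matrix.mulVec_single_one, Matrix.col_apply, matDeriv,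
    Matrix.of_apply]
  simp only [Matrix.mulVec, dotProduct, Matrix.of_apply, fderiv_apply_eq_sum_pd _ _ y]
  simp only [Finset.mul_sum, Finset.sum_mul]
  rw [Finset.sum_comm, ← Finset.sum_sub_distrib]
  refine Finset.sum_congr rfl fun k _ => ?_
  rw [← Finset.sum_sub_distrib]
  refine Finset.sum_congr rfl fun j _ => ?_
  rw [← pd]
  ring

end Geometry

section QuasiHamiltonian

variable {n : ℕ} {U : Set (Fin n → ℝ)} {g J : (Fin n → ℝ) → Matrix (Fin n) (Fin n) ℝ}
  {q : Fin n → ℝ}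

lemma adjugate_mul_inv_mul (hginv : IsUnit (g q).det) :
    (J q).adjugate * (g q)⁻¹ * (g q * J q) = (J q).det • (1 : Matrix (Fin n) (Fin n) ℝ) := by
  rw [Matrix.mul_assoc, Matrix.nonsing_inv_mul_cancel_left _ _ hginv, Matrix.adjugate_mul]

lemma adjugate_mul_inv_isSymm (hgs : (g q).IsSymm)
    (hJG : (J q)ᵀ * g q = g q * J q) (hJ : (J q).det ≠ 0) :
    ((J q).adjugate * (g q)⁻¹).IsSymm := by
  have h : (J q).adjugate * (g q)⁻¹ = (J q).det • (g q * J q)⁻¹ := by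
    rw [Matrix.mul_inv_rev, Matrix.inv_def (J q), Ring.inverse_eq_inv', Matrix.smul_mul, smul_smul,
      mul_inv_cancel₀ hJ, one_smul]
  rw [h]
  refine Matrix.IsSymm.smul ?_ _
  rw [Matrix.IsSymm, Matrix.transpose_nonsing_inv, Matrix.transpose_mul, hgs.eq, hJG]

lemma pd_quasiHamiltonian_momentum (hgs : (g q).IsSymm)
    (hJG : (J q)ᵀ * g q = g q * J q) (hJ : (J q).det ≠ 0) (V : (Fin n → ℝ) → ℝ)
    (p : Fin n → ℝ) (j : Fin n) :
    pd (fun p' => quasiHamiltonian g J V q p') j p = (((J q).adjugate * (g q)⁻¹) *ᵥ p) j :=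
  pd_dotProduct_mulVec_self (adjugate_mul_inv_isSymm hgs hJG hJ) _ _ _

/-- The position component of `(1/σ) Π_nc(J) dH` is `G p`. -/
lemma quasiHamiltonian_position (hgs : (g q).IsSymm)
    (hJG : (J q)ᵀ * g q = g q * J q) (hJ : (J q).det ≠ 0) (V : (Fin n → ℝ) → ℝ)
    (p : Fin n → ℝ) (i : Fin n) :
    (1 / (J q).det) * ∑ j, J q i j * pd (fun p' => quasiHamiltonian g J V q p') j p
      = ((g q)⁻¹ *ᵥ p) i := by
  simp only [pd_quasiHamiltonian_momentum hgs hJG hJ]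
  change _ * (J q *ᵥ (((J q).adjugate * (g q)⁻¹) *ᵥ p)) i = _
  rw [mulVec_mulVec, ← Matrix.mul_assoc, Matrix.mul_adjugate, Matrix.smul_mul, Matrix.one_mul,
    Matrix.smul_mulVec, Pi.smul_apply, smul_eq_mul]
  field_simp

/-- The momentum component of `(1/σ) Π_nc(J) dH`. -/
lemma quasiHamiltonian_momentum (hU : IsOpen U)
    (hg : ∀ i j, ContDiffOn ℝ (⊤ : ℕ∞) (fun q => g q i j) U)
    (hgsym : ∀ q ∈ U, (g q).IsSymm) (hginv : ∀ q ∈ U, IsUnit (g q).det)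
    (hJ : IsJTensor U g J) (hJns : ∀ q ∈ U, (J q).det ≠ 0)
    {V : (Fin n → ℝ) → ℝ} (hV : ContDiffOn ℝ (⊤ : ℕ∞) V U) (hq : q ∈ U)
    (p : Fin n → ℝ) (i : Fin n) :
    (1 / (J q).det) * (- (∑ j, J q j i * pd (fun q' => quasiHamiltonian g J V q' p) j q)
        + ∑ j, Omega J q p i j * pd (fun p' => quasiHamiltonian g J V q p') j p)
      = ((connMat g q ((g q)⁻¹ *ᵥ p))ᵀ *ᵥ p) i
        - (g q *ᵥ (((J q).adjugate)⁻¹ *ᵥ grad g V q)) i := by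
  obtain ⟨hJsm, hJsym, α, hα⟩ := hJ
  have hgs := hgsym q hq
  have hgi := hginv q hq
  have hJ0 := hJns q hq
  have hgd := fun i j => differentiableAt_of_contDiffOn hU (hg i j) hq
  have hJd := fun i j => differentiableAt_of_contDiffOn hU (hJsm i j) hq
  have hJG := transpose_mul_metric hgs hgi (hJsym q hq)
  simp only [pd_quasiHamiltonian_momentum hgs hJG hJ0]
  set N : (Fin n → ℝ) → Matrix (Fin n) (Fin n) ℝ := fun q' => (J q').adjugate * (g q')⁻¹
  have hNd : ∀ i j, DifferentiableAt ℝ (fun q' => N q' i j) q :=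
    differentiableAt_mul_apply (differentiableAt_adjugate_apply hJd)
      (differentiableAt_inv_apply hgd hgi.ne_zero)
  have hKd : ∀ i j, DifferentiableAt ℝ (fun q' => (g q' * J q') i j) q :=
    differentiableAt_mul_apply hgd hJd
  set w : Fin n → ℝ := (J q)⁻¹ *ᵥ ((g q)⁻¹ *ᵥ p) with hw
  have hJw : J q *ᵥ w = (g q)⁻¹ *ᵥ p := by
    rw [hw, mulVec_mulVec, Matrix.mul_nonsing_inv _ hJ0.isUnit, Matrix.one_mulVec]
  have hgJw : g q *ᵥ (J q *ᵥ w) = p := by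
    rw [hJw, mulVec_mulVec, Matrix.mul_nonsing_inv _ hgi, Matrix.one_mulVec]
  have hNp : N q *ᵥ p = (J q).det • w := by
    conv_lhs => rw [← hgJw]
    rw [mulVec_mulVec w, mulVec_mulVec, adjugate_mul_inv_mul hgi, Matrix.smul_mulVec,
      Matrix.one_mulVec]
  set u : Fin n → ℝ := Pi.single i 1 with hu
  have hdN : matDeriv N q (J q *ᵥ u) *ᵥ p = (fderiv ℝ (fun q' => (J q').det) q (J q *ᵥ u)) • w
      - N q *ᵥ (matDeriv (fun q' => g q' * J q') q (J q *ᵥ u) *ᵥ w) := by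
    have h1 := matDeriv_mul hNd hKd (J q *ᵥ u)
    have h2 : matDeriv (fun q' => N q' * (g q' * J q')) q (J q *ᵥ u) =
        (fderiv ℝ (fun q' => (J q').det) q (J q *ᵥ u)) • (1 : Matrix (Fin n) (Fin n) ℝ) := by
      ext a b
      have hev : (fun q' => (N q' * (g q' * J q')) a b) =ᶠ[nhds q]
          fun q' => (J q').det * (1 : Matrix (Fin n) (Fin n) ℝ) a b := by
        filter_upwards [hU.mem_nhds hq] with q' hq'
        rw [adjugate_mul_inv_mul (hginv q' hq')]
        rfl
      rw [matDeriv, Matrix.of_apply, hev.fderiv_eq, fderiv_mul_const (differentiableAt_det hJd)]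
      simp [mul_comm]
    have h3 : matDeriv N q (J q *ᵥ u) *ᵥ p =
        (matDeriv N q (J q *ᵥ u) * (g q * J q)) *ᵥ w := by
      rw [← mulVec_mulVec, ← mulVec_mulVec, hgJw]
    rw [h3, eq_sub_of_add_eq (h1.symm.trans h2), Matrix.sub_mulVec, Matrix.smul_mulVec,
      Matrix.one_mulVec, ← mulVec_mulVec w]
  have hpN : ∀ z, p ⬝ᵥ (N q *ᵥ z) = (J q).det * (w ⬝ᵥ z) := fun z => by
    rw [dotProduct_mulVec_eq_transpose, (adjugate_mul_inv_isSymm hgs hJG hJ0).eq, hNp,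
      smul_dotProduct, smul_eq_mul]
  have hHq : ∑ j, J q j i * pd (fun q' => quasiHamiltonian g J V q' p) j q =
      (1 / 2) * (p ⬝ᵥ (matDeriv N q (J q *ᵥ u) *ᵥ p)) + ((J q)ᵀ *ᵥ fun j => pd V j q) i := by
    have hd : fderiv ℝ (fun q' => quasiHamiltonian g J V q' p) q = _ :=
      (((hasFDerivAt_dotProduct_mulVec hNd p).const_mul (1 / 2)).add
        (differentiableAt_of_contDiffOn hU hV hq).hasFDerivAt).fderiv
    have hcol : ∀ j, J q j i = (J q *ᵥ u) j := fun j => by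
      rw [hu, Matrix.mulVec_single_one, Matrix.col_apply]
    have hVs : ((J q)ᵀ *ᵥ fun j => pd V j q) i = fderiv ℝ V q (J q *ᵥ u) := by
      rw [fderiv_apply_eq_sum_pd]
      simp only [← hcol]
      rfl
    rw [hVs]
    simp only [hcol]
    rw [← fderiv_apply_eq_sum_pd, hd]
    simp [matDeriv, Matrix.mulVec, dotProduct, mul_comm]
  have hpot : g q *ᵥ (((J q).adjugate)⁻¹ *ᵥ grad g V q) =
      (1 / (J q).det) • ((J q)ᵀ *ᵥ fun j => pd V j q) := by
    have hinv : ((J q).adjugate)⁻¹ = (1 / (J q).det) • J q := by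
      refine Matrix.inv_eq_right_inv ?_
      rw [Matrix.mul_smul, Matrix.adjugate_mul, smul_smul, one_div, inv_mul_cancel₀ hJ0, one_smul]
    rw [hinv, grad, Matrix.smul_mulVec, Matrix.mulVec_smul, mulVec_mulVec, mulVec_mulVec,
      ← hJG, Matrix.mul_nonsing_inv_cancel_right _ _ hgi]
  have hΓ : ((connMat g q ((g q)⁻¹ *ᵥ p))ᵀ *ᵥ p) i =
      p ⬝ᵥ (connMat g q u *ᵥ ((g q)⁻¹ *ᵥ p)) := by
    rw [connMat_mulVec_comm hU hgsym hq, dotProduct_mulVec_eq_transpose, hu,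
      dotProduct_single_one]
  have hdJ : ∀ x y, matDeriv J q x *ᵥ y = (α q ⬝ᵥ y) • x
      + ((g q *ᵥ x) ⬝ᵥ y) • ((g q)⁻¹ *ᵥ α q) - connMat g q x *ᵥ (J q *ᵥ y)
      + J q *ᵥ (connMat g q x *ᵥ y) := fun x y => by
    rw [matDeriv_of_covDeriv (hα q hq), Matrix.add_mulVec, Matrix.sub_mulVec, Matrix.add_mulVec,
      Matrix.vecMulVec_mulVec, Matrix.vecMulVec_mulVec, ← mulVec_mulVec, ← mulVec_mulVec]
    simp
  have hkin := kinetic_identity (g := g q) (J := J q) (dg := matDeriv g q) (dJ := matDeriv J q)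
    (Γ := connMat g q) (a := (g q)⁻¹ *ᵥ α q) (α := α q) hgs.eq
    (by rw [mulVec_mulVec, Matrix.mul_nonsing_inv _ hgi, Matrix.one_mulVec]) hJG
    (connMat_mulVec_comm hU hgsym hq) (matDeriv_metric hU hgsym hgi hq) hdJ w u
  rw [hgJw, hJw] at hkin
  have hOm : ∑ j, Omega J q p i j * (N q *ᵥ p) j =
      (J q).det * (p ⬝ᵥ (matDeriv J q w *ᵥ u) - p ⬝ᵥ (matDeriv J q u *ᵥ w)) := by
    rw [hNp, ← sum_Omega_mul, Finset.mul_sum]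
    refine Finset.sum_congr rfl fun j _ => ?_
    rw [Pi.smul_apply, smul_eq_mul]
    ring
  rw [hOm, hHq, hdN, hpot, hΓ, ← hkin, dotProduct_sub, hpN, dotProduct_smul,
    fderiv_det_of_covDeriv hgs hgi hJG hJd (hα q hq), matDeriv_mul hgd hJd, dotProduct_comm p w,
    Pi.smul_apply]
  simp only [smul_eq_mul]
  field_simp
  ring

/-- Along a curve, the momentum `p = g q̇` satisfies `ṗ = Γ(q̇)ᵀ p + g (q̈ + Γ(q̇) q̇)`. -/
lemma deriv_metric_mulVec_velocity (hU : IsOpen U)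
    (hg : ∀ i j, ContDiffOn ℝ (⊤ : ℕ∞) (fun q => g q i j) U)
    (hgsym : ∀ q ∈ U, (g q).IsSymm) (hginv : ∀ q ∈ U, IsUnit (g q).det)
    {I : Set ℝ} (hI : IsOpen I) {c : ℝ → Fin n → ℝ}
    (hc : ∀ i, ContDiffOn ℝ (⊤ : ℕ∞) (fun t => c t i) I) {t : ℝ} (ht : t ∈ I)
    (hct : c t ∈ U) {v : ℝ → Fin n → ℝ} (hv : v = fun t i => deriv (fun s => c s i) t)
    (i : Fin n) :
    deriv (fun s => (g (c s) *ᵥ v s) i) t =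
      ((connMat g (c t) (v t))ᵀ *ᵥ (g (c t) *ᵥ v t)
        + g (c t) *ᵥ ((fun k => deriv (fun s => v s k) t) + connMat g (c t) (v t) *ᵥ v t)) i := by
  have hcd : HasDerivAt c (v t) t := by
    rw [hasDerivAt_pi, hv]
    exact fun k => (differentiableAt_of_contDiffOn hI (hc k) ht).hasDerivAt
  have hvd : ∀ k, HasDerivAt (fun s => v s k) (deriv (fun s => v s k) t) t := fun k => by
    have h1 : ContDiffOn ℝ (⊤ : ℕ∞) (fun s => v s k) I := by
      rw [hv]
      exact ((contDiffOn_infty_iff_deriv_of_isOpen hI).1 (hc k)).2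
    exact (differentiableAt_of_contDiffOn hI h1 ht).hasDerivAt
  have hgd : ∀ k, HasDerivAt (fun s => g (c s) i k) (matDeriv g (c t) (v t) i k) t := fun k =>
    (differentiableAt_of_contDiffOn hU (hg i k) hct).hasFDerivAt.comp_hasDerivAt t hcd
  have h : deriv (fun s => (g (c s) *ᵥ v s) i) t = _ :=
    (HasDerivAt.fun_sum (u := Finset.univ) fun k _ => (hgd k).mul (hvd k)).deriv
  rw [h, Finset.sum_add_distrib]
  change (matDeriv g (c t) (v t) *ᵥ v t) i + (g (c t) *ᵥ fun k => deriv (fun s => v s k) t) i = _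
  rw [matDeriv_metric hU hgsym (hginv _ hct) hct, Matrix.add_mulVec, Matrix.mulVec_add,
    ← mulVec_mulVec, ← mulVec_mulVec]
  simp only [Pi.add_apply]
  ring

end QuasiHamiltonian

/-- For a bi-cofactor system the two quasi-Hamiltonian vector
fields `(1/σ₁)Π_nc(J₁)dH` and `(1/σ₂)Π_nc(J₂)dF` coincide, and a curve solves
the bi-cofactor Newton system iff its canonical lift is an integral curve of
this common vector field. -/
theorem bicofactor_biquasiHamiltonian_representation
    (n : ℕ) (U : Set (Fin n → ℝ)) (hU : IsOpen U)
    (g : (Fin n → ℝ) → Matrix (Fin n) (Fin n) ℝ)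
    (hg : ∀ i j, ContDiffOn ℝ (⊤ : ℕ∞) (fun q => g q i j) U)
    (hgsym : ∀ q ∈ U, (g q).IsSymm) (hginv : ∀ q ∈ U, IsUnit (g q).det)
    (J₁ J₂ : (Fin n → ℝ) → Matrix (Fin n) (Fin n) ℝ)
    (hJ₁ : IsJTensor U g J₁) (hJ₂ : IsJTensor U g J₂)
    (hJ₁ns : ∀ q ∈ U, (J₁ q).det ≠ 0) (hJ₂ns : ∀ q ∈ U, (J₂ q).det ≠ 0)
    (σ₁ σ₂ : (Fin n → ℝ) → ℝ)
    (hσ₁ : σ₁ = fun q => (J₁ q).det) (hσ₂ : σ₂ = fun q => (J₂ q).det)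
    (V W : (Fin n → ℝ) → ℝ) (hV : ContDiffOn ℝ (⊤ : ℕ∞) V U) (hW : ContDiffOn ℝ (⊤ : ℕ∞) W U)
    -- the bi-cofactor condition
    (hbi : ∀ q ∈ U,
      ((J₁ q).adjugate)⁻¹ *ᵥ grad g V q = ((J₂ q).adjugate)⁻¹ *ᵥ grad g W q)
    (H F : (Fin n → ℝ) → (Fin n → ℝ) → ℝ)
    (hH : H = fun q p => (1 / 2) * (p ⬝ᵥ (((J₁ q).adjugate * (g q)⁻¹) *ᵥ p)) + V q)
    (hF : F = fun q p => (1 / 2) * (p ⬝ᵥ (((J₂ q).adjugate * (g q)⁻¹) *ᵥ p)) + W q) :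
    -- (1) the two quasi-Hamiltonian vector fields coincide on U × ℝⁿ
    (∀ q ∈ U, ∀ p : Fin n → ℝ, ∀ i,
      ((1 / σ₁ q) * ∑ j, J₁ q i j * pd (fun p' => H q p') j p
        = (1 / σ₂ q) * ∑ j, J₂ q i j * pd (fun p' => F q p') j p)
      ∧
      ((1 / σ₁ q) * (- (∑ j, J₁ q j i * pd (fun q' => H q' p) j q)
            + ∑ j, Omega J₁ q p i j * pd (fun p' => H q p') j p)
        = (1 / σ₂ q) * (- (∑ j, J₂ q j i * pd (fun q' => F q' p) j q)
            + ∑ j, Omega J₂ q p i j * pd (fun p' => F q p') j p)))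
    ∧
    -- (2) Newton system ↔ integral curve of the common vector field
    (∀ (I : Set ℝ), IsOpen I →
      ∀ (c : ℝ → (Fin n → ℝ)), (∀ i, ContDiffOn ℝ (⊤ : ℕ∞) (fun t => c t i) I) →
      (∀ t ∈ I, c t ∈ U) →
      ∀ (pc : ℝ → (Fin n → ℝ)),
      (∀ t, pc t = g (c t) *ᵥ (fun i => deriv (fun s => c s i) t)) →
      ((∀ t ∈ I, ∀ i,
        deriv (fun s => deriv (fun u => c u i) s) t
          + ∑ j, ∑ k, christoffel g i j k (c t)
              * deriv (fun u => c u j) t * deriv (fun u => c u k) t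
        = - (((J₁ (c t)).adjugate)⁻¹ *ᵥ grad g V (c t)) i)
      ↔
      (∀ t ∈ I, ∀ i,
        (deriv (fun s => c s i) t
          = (1 / σ₁ (c t)) * ∑ j, J₁ (c t) i j * pd (fun p' => H (c t) p') j (pc t))
        ∧
        (deriv (fun s => pc s i) t
          = (1 / σ₁ (c t)) *
              (- (∑ j, J₁ (c t) j i * pd (fun q' => H q' (pc t)) j (c t))
                + ∑ j, Omega J₁ (c t) (pc t) i j
                    * pd (fun p' => H (c t) p') j (pc t)))))) := by
  have hH' : H = quasiHamiltonian g J₁ V := hH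
  have hF' : F = quasiHamiltonian g J₂ W := hF
  subst hH' hF' hσ₁ hσ₂
  refine ⟨fun q hq p i => ⟨?_, ?_⟩, ?_⟩
  · have hs₁ := transpose_mul_metric (hgsym q hq) (hginv q hq) (hJ₁.2.1 q hq)
    have hs₂ := transpose_mul_metric (hgsym q hq) (hginv q hq) (hJ₂.2.1 q hq)
    rw [quasiHamiltonian_position (hgsym q hq) hs₁ (hJ₁ns q hq),
      quasiHamiltonian_position (hgsym q hq) hs₂ (hJ₂ns q hq)]
  · rw [quasiHamiltonian_momentum hU hg hgsym hginv hJ₁ hJ₁ns hV hq,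
      quasiHamiltonian_momentum hU hg hgsym hginv hJ₂ hJ₂ns hW hq, hbi q hq]
  · intro I hI c hc hcU pc hpc
    refine forall₂_congr fun t ht => ?_
    have hq := hcU t ht
    have hgi := hginv _ hq
    have hs := transpose_mul_metric (hgsym _ hq) hgi (hJ₁.2.1 _ hq)
    set v : ℝ → Fin n → ℝ := fun t i => deriv (fun s => c s i) t with hv
    set f := ((J₁ (c t)).adjugate)⁻¹ *ᵥ grad g V (c t) with hf
    set a : Fin n → ℝ := (fun k => deriv (fun s => v s k) t) + connMat g (c t) (v t) *ᵥ v t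
      with ha
    have hpct : (g (c t))⁻¹ *ᵥ pc t = v t := by
      rw [hpc t, mulVec_mulVec, Matrix.nonsing_inv_mul _ hgi, Matrix.one_mulVec]
    have hN : ∀ i, deriv (fun s => deriv (fun u => c u i) s) t
        + ∑ j, ∑ k, christoffel g i j k (c t)
          * deriv (fun u => c u j) t * deriv (fun u => c u k) t = a i := fun i => by
      simp only [ha, Pi.add_apply, connMat, Matrix.mulVec, dotProduct, Matrix.of_apply,
        Finset.sum_mul]
      rw [Finset.sum_comm]
      congr 1
      exact Finset.sum_congr rfl fun k _ => Finset.sum_congr rfl fun j _ => by ring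
    have hpd : ∀ i, deriv (fun s => pc s i) t =
        ((connMat g (c t) (v t))ᵀ *ᵥ pc t + g (c t) *ᵥ a) i := fun i => by
      simp only [hpc]
      exact deriv_metric_mulVec_velocity hU hg hgsym hginv hI hc ht hq hv i
    have hinj : a = -f ↔ g (c t) *ᵥ a = -(g (c t) *ᵥ f) := by
      rw [← Matrix.mulVec_neg f]
      exact (Matrix.mulVec_injective_of_isUnit
        ((Matrix.isUnit_iff_isUnit_det _).2 hgi)).eq_iff.symm
    simp only [hN, quasiHamiltonian_position (hgsym _ hq) hs (hJ₁ns _ hq),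
      quasiHamiltonian_momentum hU hg hgsym hginv hJ₁ hJ₁ns hV hq, hpct, hpd, ← hf]
    calc (∀ i, a i = -f i) ↔ a = -f := funext_iff.symm
      _ ↔ _ := hinj
      _ ↔ _ := by
        rw [funext_iff]
        refine forall_congr' fun i => ?_
        rw [Pi.add_apply, sub_eq_add_neg, add_right_inj]
        exact (and_iff_right rfl).symm
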